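/- For every w > 0 and every ρ with −1 < ρ < 1, the function ρ ↦ P₃₃(ρ,w) is twice differentiable at ρ, and its second derivative equals (1/(2π))·(1/√(1−ρ²))·exp(−w²/(1+ρ))·[ρ/(1−ρ²) + w²/(1+ρ)²]. -/

import Mathlib

open MeasureTheory Real

/-- Standard bivariate normal density with correlation `ρ`. -/
noncomputable def f (ρ x y : ℝ) : ℝ :=
  (1 / (2 * Real.pi * Real.sqrt (1 - ρ ^ 2))) *
    Real.exp (-(x ^ 2 - 2 * ρ * x * y + y ^ 2) / (2 * (1 - ρ ^ 2)))

noncomputable def P33 (ρ w : ℝ) : ℝ := ∫ x in Set.Ioi w, ∫ y in Set.Ioi w, f ρ x y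

open Filter Topology Set

noncomputable def gK (z : ℝ) : ℝ := Real.exp (-(1/2) * z ^ 2)

noncomputable def gG (t : ℝ) : ℝ := ∫ z in Ioi t, gK z

lemma gK_int : Integrable gK := integrable_exp_neg_mul_sq (by norm_num)

lemma gK_cont : Continuous gK := by unfold gK; fun_prop

lemma gK_pos (x : ℝ) : 0 < gK x := Real.exp_pos _

lemma gK_le_one (x : ℝ) : gK x ≤ 1 := by
  unfold gK
  apply Real.exp_le_one_iff.2
  nlinarith [sq_nonneg x]

lemma gK_deriv (x : ℝ) : HasDerivAt gK (-x * gK x) x := by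
  unfold gK
  have h : HasDerivAt (fun z : ℝ => -(1/2) * z ^ 2) (-x) x := by
    have := (hasDerivAt_pow 2 x).const_mul (-(1/2) : ℝ)
    refine HasDerivAt.congr_deriv (this) ?_
    simp
  refine HasDerivAt.congr_deriv (h.exp) ?_
  ring

lemma gK_tendsto : Tendsto gK atTop (𝓝 0) := by
  unfold gK
  apply Real.tendsto_exp_atBot.comp
  exact (tendsto_pow_atTop (by norm_num)).const_mul_atTop_of_neg (by norm_num)

lemma gG_deriv (t : ℝ) : HasDerivAt gG (-gK t) t := by
  have h : gG = fun t => gG 0 - ∫ z in (0:ℝ)..t, gK z := by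
    funext t
    have := intervalIntegral.integral_Ioi_sub_Ioi' (a := 0) (b := t) gK_int.integrableOn gK_int.integrableOn
    unfold gG
    rw [← this]; ring
  rw [h]
  have := (gK_cont.integral_hasStrictDerivAt 0 t).hasDerivAt
  exact this.const_sub _

lemma gG_cont : Continuous gG := by
  rw [continuous_iff_continuousAt]
  exact fun t => (gG_deriv t).continuousAt

lemma gG_bound (t : ℝ) : ‖gG t‖ ≤ ∫ z, gK z := by
  have h0 : 0 ≤ gG t := integral_nonneg fun z => (gK_pos z).le
  rw [Real.norm_of_nonneg h0]
  exact setIntegral_le_integral gK_int (Eventually.of_forall fun z => (gK_pos z).le)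

lemma shift_int (w c s : ℝ) (hs : 0 < s) :
    ∫ y in Ioi w, gK (s⁻¹ * (y - c)) = s * gG ((w - c) / s) := by
  have h1 := (measurePreserving_sub_right volume c).setIntegral_preimage_emb
    (MeasurableEquiv.subRight c).measurableEmbedding (fun y => gK (s⁻¹ * y)) (Ioi (w - c))
  have h2 : (fun x => x - c) ⁻¹' Ioi (w - c) = Ioi w := by
    ext y; simp
  rw [h2] at h1
  rw [h1, integral_comp_mul_left_Ioi gK (w - c) (inv_pos.2 hs)]
  rw [inv_inv, smul_eq_mul, inv_mul_eq_div]
  rfl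

lemma f_eq (r x y : ℝ) (h : 0 < 1 - r ^ 2) :
    f r x y = (1 / (2 * π * √(1 - r ^ 2))) * (gK x * gK ((√(1 - r ^ 2))⁻¹ * (y - r * x))) := by
  unfold f gK
  rw [← Real.exp_add, mul_pow, inv_pow, Real.sq_sqrt h.le]
  congr 2
  field_simp
  ring

lemma f_symm (r x y : ℝ) : f r x y = f r y x := by
  unfold f
  congr 3
  ring

lemma P33_eq (r w : ℝ) (h : 0 < 1 - r ^ 2) :
    P33 r w = 1 / (2 * π) * ∫ x in Ioi w, gK x * gG ((w - r * x) / √(1 - r ^ 2)) := by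
  unfold P33
  rw [← integral_const_mul]
  congr 1
  funext x
  have hs : 0 < √(1 - r ^ 2) := Real.sqrt_pos.2 h
  simp_rw [f_eq r x _ h]
  rw [integral_const_mul, integral_const_mul, shift_int _ _ _ hs]
  field_simp

lemma sqrt_deriv (r : ℝ) (h : 0 < 1 - r ^ 2) :
    HasDerivAt (fun r : ℝ => √(1 - r ^ 2)) (-r / √(1 - r ^ 2)) r := by
  have h1 : HasDerivAt (fun r : ℝ => 1 - r ^ 2) (-(2 * r)) r := by
    have := (hasDerivAt_pow 2 r).const_sub (1:ℝ)
    refine HasDerivAt.congr_deriv (this) ?_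
    simp
  refine HasDerivAt.congr_deriv (h1.sqrt h.ne') ?_
  have hs : 0 < √(1 - r ^ 2) := Real.sqrt_pos.2 h
  field_simp

lemma t_deriv (w x r : ℝ) (h : 0 < 1 - r ^ 2) :
    HasDerivAt (fun r : ℝ => (w - r * x) / √(1 - r ^ 2)) (-(x - r * w) / √(1 - r ^ 2) ^ 3) r := by
  have hs : 0 < √(1 - r ^ 2) := Real.sqrt_pos.2 h
  have h1 : HasDerivAt (fun r : ℝ => w - r * x) (-x) r := by
    simpa using ((hasDerivAt_id r).mul_const x).const_sub w
  refine HasDerivAt.congr_deriv (h1.div (sqrt_deriv r h) hs.ne') ?_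
  have h2 := Real.sq_sqrt h.le
  field_simp
  rw [h2]
  ring

noncomputable def gF' (w r x : ℝ) : ℝ :=
  gK x * (gK ((w - r * x) / √(1 - r ^ 2)) * ((x - r * w) / √(1 - r ^ 2) ^ 3))

lemma F_deriv (w x r : ℝ) (h : 0 < 1 - r ^ 2) :
    HasDerivAt (fun r : ℝ => gK x * gG ((w - r * x) / √(1 - r ^ 2))) (gF' w r x) r := by
  have := ((gG_deriv _).comp r (t_deriv w x r h)).const_mul (gK x)
  refine HasDerivAt.congr_deriv (this) ?_
  unfold gF'
  ring

lemma prim_deriv (w x r : ℝ) (h : 0 < 1 - r ^ 2) :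
    HasDerivAt (fun x : ℝ => -((√(1 - r ^ 2))⁻¹ * (gK x * gK ((w - r * x) / √(1 - r ^ 2)))))
      (gF' w r x) x := by
  have hs : 0 < √(1 - r ^ 2) := Real.sqrt_pos.2 h
  have h1 : HasDerivAt (fun x : ℝ => (w - r * x) / √(1 - r ^ 2)) (-r / √(1 - r ^ 2)) x := by
    simpa using (((hasDerivAt_id x).const_mul r).const_sub w).div_const (√(1 - r ^ 2))
  have := (((gK_deriv x).mul ((gK_deriv _).comp x h1)).const_mul (√(1 - r ^ 2))⁻¹).neg
  refine HasDerivAt.congr_deriv (this) ?_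
  unfold gF'
  have h2 := Real.sq_sqrt h.le
  simp only [Function.comp]
  generalize gK ((w - r * x) / √(1 - r ^ 2)) = A
  field_simp
  rw [h2]
  ring

lemma gK_abs_int (w C : ℝ) : Integrable fun x => gK x * ((|x| + w) * C) := by
  have h1 : Integrable fun x : ℝ => ‖x * gK x‖ :=
    (integrable_mul_exp_neg_mul_sq (b := 1/2) (by norm_num)).norm
  have h2 := (h1.add (gK_int.mul_const w)).mul_const C
  refine h2.congr (Eventually.of_forall fun x => ?_)
  simp only [Pi.add_apply, norm_mul, Real.norm_eq_abs, abs_of_pos (gK_pos x)]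
  ring

lemma P33_deriv (w : ℝ) (hw : 0 < w) (ρ : ℝ) (h1 : -1 < ρ) (h2 : ρ < 1) :
    HasDerivAt (fun r => P33 r w) (f ρ w w) ρ := by
  have hρ : |ρ| < 1 := abs_lt.2 ⟨h1, h2⟩
  obtain ⟨a, ha1, ha2⟩ := exists_between hρ
  have ha0 : 0 ≤ a := (abs_nonneg ρ).trans ha1.le
  have hc : 0 < 1 - a ^ 2 := by nlinarith
  have hnhds : Ioo (-a) a ∈ 𝓝 ρ := Ioo_mem_nhds (abs_lt.1 ha1).1 (abs_lt.1 ha1).2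
  have hle : ∀ r ∈ Ioo (-a) a, 1 - a ^ 2 ≤ 1 - r ^ 2 := by
    intro r hr
    nlinarith [hr.1, hr.2]
  have hpos : ∀ r ∈ Ioo (-a) a, 0 < 1 - r ^ 2 := fun r hr => hc.trans_le (hle r hr)
  have hρpos := hpos ρ (mem_of_mem_nhds hnhds)
  have hFc : ∀ r, Continuous fun x => gK x * gG ((w - r * x) / √(1 - r ^ 2)) := by
    intro r
    have := gK_cont
    have := gG_cont
    fun_prop
  have hF'c : Continuous (gF' w ρ) := by
    unfold gF'
    have := gK_cont
    fun_prop
  have key := hasDerivAt_integral_of_dominated_loc_of_deriv_le (μ := volume.restrict (Ioi w))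
    (F := fun r x => gK x * gG ((w - r * x) / √(1 - r ^ 2))) (F' := gF' w)
    (bound := fun x => gK x * ((|x| + w) * (1 / √(1 - a ^ 2) ^ 3))) hnhds
    (Eventually.of_forall fun r => (hFc r).aestronglyMeasurable)
    (by
      have : Integrable fun x => gK x * gG ((w - ρ * x) / √(1 - ρ ^ 2)) := by
        refine (gK_int.mul_const (∫ z, gK z)).mono' (hFc ρ).aestronglyMeasurable
          (Eventually.of_forall fun x => ?_)
        rw [norm_mul, Real.norm_of_nonneg (gK_pos x).le]
        exact mul_le_mul_of_nonneg_left (gG_bound _) (gK_pos x).le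
      exact this.integrableOn)
    hF'c.aestronglyMeasurable
    (Eventually.of_forall fun x r hr => by
      have hs : 0 < √(1 - a ^ 2) := Real.sqrt_pos.2 hc
      have hs2 : √(1 - a ^ 2) ≤ √(1 - r ^ 2) := Real.sqrt_le_sqrt (hle r hr)
      have hs3 : 0 < √(1 - r ^ 2) := hs.trans_le hs2
      unfold gF'
      rw [norm_mul, Real.norm_of_nonneg (gK_pos x).le]
      refine mul_le_mul_of_nonneg_left ?_ (gK_pos x).le
      rw [norm_mul, Real.norm_of_nonneg (gK_pos _).le, norm_div, Real.norm_eq_abs,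
        Real.norm_of_nonneg (pow_pos hs3 3).le]
      have hb : |x - r * w| ≤ |x| + w := by
        have hr1 : |r| ≤ 1 := (abs_lt.2 ⟨hr.1, hr.2⟩).le.trans ha2.le
        calc |x - r * w| ≤ |x| + |r * w| := abs_sub _ _
          _ ≤ |x| + w := by
            rw [abs_mul, abs_of_pos hw]
            nlinarith
      calc _ ≤ 1 * (|x - r * w| / √(1 - r ^ 2) ^ 3) :=
            mul_le_mul_of_nonneg_right (gK_le_one _) (by positivity)
        _ = |x - r * w| / √(1 - r ^ 2) ^ 3 := one_mul _
        _ ≤ (|x| + w) / √(1 - a ^ 2) ^ 3 := by gcongr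
        _ = _ := by ring)
    (gK_abs_int w _).integrableOn
    (Eventually.of_forall fun x r hr => F_deriv w x r (hpos r hr))
  have hs : 0 < √(1 - ρ ^ 2) := Real.sqrt_pos.2 hρpos
  have hint : ∫ x in Ioi w, gF' w ρ x
      = (√(1 - ρ ^ 2))⁻¹ * (gK w * gK ((w - ρ * w) / √(1 - ρ ^ 2))) := by
    rw [integral_Ioi_of_hasDerivAt_of_tendsto' (fun x _ => prim_deriv w x ρ hρpos) key.1 (m := 0)]
    · ring
    · have : Tendsto (fun x => (√(1 - ρ ^ 2))⁻¹ * (gK x * gK ((w - ρ * x) / √(1 - ρ ^ 2))))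
          atTop (𝓝 0) := by
        refine squeeze_zero (fun x => ?_) (fun x => ?_)
          (by simpa using gK_tendsto.const_mul (√(1 - ρ ^ 2))⁻¹)
        · have := gK_pos x
          have := gK_pos ((w - ρ * x) / √(1 - ρ ^ 2))
          positivity
        · refine mul_le_mul_of_nonneg_left ?_ (by positivity)
          exact mul_le_of_le_one_right (gK_pos x).le (gK_le_one _)
      simpa using this.neg
  have h3 := key.2.const_mul (1 / (2 * π))
  rw [hint] at h3
  have h4 : f ρ w w = 1 / (2 * π) *
      ((√(1 - ρ ^ 2))⁻¹ * (gK w * gK ((w - ρ * w) / √(1 - ρ ^ 2)))) := by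
    rw [f_eq ρ w w hρpos, inv_mul_eq_div]
    field_simp
  rw [h4]
  refine h3.congr_of_eventuallyEq ?_
  filter_upwards [hnhds] with r hr
  exact P33_eq r w (hpos r hr)

lemma f_diag (w r : ℝ) (h1 : -1 < r) (h2 : r < 1) :
    f r w w = 1 / (2 * π) * ((√(1 - r ^ 2))⁻¹ * Real.exp (-w ^ 2 / (1 + r))) := by
  have ha : 0 < 1 + r := by linarith
  have hb : 0 < 1 - r := by linarith
  have hc : 1 - r ^ 2 = (1 + r) * (1 - r) := by ring
  unfold f
  have : -(w ^ 2 - 2 * r * w * w + w ^ 2) / (2 * (1 - r ^ 2)) = -w ^ 2 / (1 + r) := by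
    rw [hc]
    field_simp
    ring
  rw [this]
  have hs : 0 < √(1 - r ^ 2) := Real.sqrt_pos.2 (by rw [hc]; positivity)
  field_simp

lemma second_deriv (w ρ : ℝ) (h1 : -1 < ρ) (h2 : ρ < 1) :
    HasDerivAt (fun r => 1 / (2 * π) * ((√(1 - r ^ 2))⁻¹ * Real.exp (-w ^ 2 / (1 + r))))
      ((1 / (2 * Real.pi)) * (1 / Real.sqrt (1 - ρ ^ 2)) * Real.exp (-w ^ 2 / (1 + ρ)) *
        (ρ / (1 - ρ ^ 2) + w ^ 2 / (1 + ρ) ^ 2)) ρ := by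
  have ha : 0 < 1 + ρ := by linarith
  have h : 0 < 1 - ρ ^ 2 := by nlinarith
  have hs : 0 < √(1 - ρ ^ 2) := Real.sqrt_pos.2 h
  have e1 := (sqrt_deriv ρ h).inv hs.ne'
  have e2 : HasDerivAt (fun r : ℝ => -w ^ 2 / (1 + r)) (w ^ 2 / (1 + ρ) ^ 2) ρ := by
    have := (hasDerivAt_const ρ (-w ^ 2)).div ((hasDerivAt_id ρ).const_add 1) ha.ne'
    refine HasDerivAt.congr_deriv (this) ?_
    simp
  refine HasDerivAt.congr_deriv ((e1.mul e2.exp).const_mul (1 / (2 * π))) ?_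
  have h3 := Real.sq_sqrt h.le
  rw [h3, Pi.inv_apply]
  generalize Real.exp _ = E
  generalize 1 - ρ ^ 2 = A at *
  field_simp

theorem stmt12 (w : ℝ) (hw : 0 < w) (ρ : ℝ) (h1 : -1 < ρ) (h2 : ρ < 1) :
    DifferentiableAt ℝ (fun r => P33 r w) ρ ∧
    DifferentiableAt ℝ (deriv (fun r => P33 r w)) ρ ∧
    deriv (deriv (fun r => P33 r w)) ρ =
      (1 / (2 * Real.pi)) * (1 / Real.sqrt (1 - ρ ^ 2)) * Real.exp (-w ^ 2 / (1 + ρ)) *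
        (ρ / (1 - ρ ^ 2) + w ^ 2 / (1 + ρ) ^ 2) := by
  have hev : deriv (fun r => P33 r w) =ᶠ[𝓝 ρ]
      fun r => 1 / (2 * π) * ((√(1 - r ^ 2))⁻¹ * Real.exp (-w ^ 2 / (1 + r))) := by
    filter_upwards [Ioo_mem_nhds h1 h2] with r hr
    rw [(P33_deriv w hw r hr.1 hr.2).deriv, f_diag w r hr.1 hr.2]
  have hd := (second_deriv w ρ h1 h2).congr_of_eventuallyEq hev
  exact ⟨(P33_deriv w hw ρ h1 h2).differentiableAt, hd.differentiableAt, hd.deriv⟩
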